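/- Let n ≥ 1, let a ∈ ℝ^n be ℚ-independent, let b ∈ ℝ^n, and suppose the flow generated by the constant vector field a is smoothly semiconjugate to the flow generated by the constant vector field b by a surjective map V : T^n → T^n (V admits a C^∞ lift W with (DW(x))a = b for all x). Let α ∈ ℝ∖{0} and let R be a generalized symmetry with multiplier α of the flow generated by a (a diffeomorphism of T^n whose lifts R̂ satisfy (DR̂(x))a = αa for all x). Then there exist a positive integer k and a generalized symmetry Q with multiplier α^k of the flow generated by b (a diffeomorphism of T^n whose lifts Q̂ satisfy (DQ̂(x))b = α^k b for all x) such that Q ∘ V = V ∘ R^k, where R^k is the k-fold composite of R. -/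

import Mathlib

noncomputable section

/-- Euclidean space `ℝ^n`. -/
abbrev Eucl (n : ℕ) := Fin n → ℝ

/-- The inclusion of the integer lattice `ℤ^n` into `ℝ^n`. -/
def intVec {n : ℕ} (m : Fin n → ℤ) : Eucl n := fun i => (m i : ℝ)

/-- The integer lattice `ℤ^n` as an additive subgroup of `ℝ^n`. -/
def intLattice (n : ℕ) : AddSubgroup (Eucl n) where
  carrier := Set.range (intVec (n := n))
  add_mem' := by
    rintro _ _ ⟨p, rfl⟩ ⟨q, rfl⟩
    exact ⟨p + q, by funext i; simp [intVec]⟩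
  zero_mem' := ⟨0, by funext i; simp [intVec]⟩
  neg_mem' := by
    rintro _ ⟨p, rfl⟩
    exact ⟨-p, by funext i; simp [intVec]⟩

/-- The `n`-torus `T^n = ℝ^n / ℤ^n`. -/
abbrev Torus (n : ℕ) := Eucl n ⧸ intLattice n

/-- The covering projection `π : ℝ^n → T^n`. -/
def torusPi (n : ℕ) : Eucl n → Torus n := QuotientAddGroup.mk

/-- `W : ℝ^n → ℝ^n` is a lift of `V : T^n → T^n`, i.e. `V ∘ π = π ∘ W`. -/
def IsLift {n : ℕ} (V : Torus n → Torus n) (W : Eucl n → Eucl n) : Prop :=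
  ∀ x, V (torusPi n x) = torusPi n (W x)

/-- An integer matrix viewed as a real matrix. -/
def matR {n : ℕ} (B : Matrix (Fin n) (Fin n) ℤ) : Matrix (Fin n) (Fin n) ℝ :=
  B.map Int.cast

/-- `W` is a `C^∞` diffeomorphism of `ℝ^n`. -/
def SmoothDiffeoR {n : ℕ} (W : Eucl n → Eucl n) : Prop :=
  ContDiff ℝ (⊤ : ℕ∞) W ∧ ∃ W' : Eucl n → Eucl n, ContDiff ℝ (⊤ : ℕ∞) W' ∧
    Function.LeftInverse W' W ∧ Function.RightInverse W' W

/-- The components of `a ∈ ℝ^n` are linearly independent over `ℚ`. -/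
def QIndep {n : ℕ} (a : Eucl n) : Prop := LinearIndependent ℚ a

/-- `R` is a generalized symmetry, with multiplier `α`, of the flow on `T^n` generated by the
constant vector field `a`: `R` is a diffeomorphism of the torus (a bijection admitting a smooth
diffeomorphism lift) and a lift `R̂` satisfies `(DR̂(x))a = αa` for all `x`. -/
def IsGenSym {n : ℕ} (a : Eucl n) (α : ℝ) (R : Torus n → Torus n) : Prop :=
  Function.Bijective R ∧ ∃ Rh : Eucl n → Eucl n, IsLift R Rh ∧ SmoothDiffeoR Rh ∧
    ∀ x, fderiv ℝ Rh x a = α • a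

/-- The multiplier group `M_a ⊆ ℝ \ {0}` of the flow generated by the constant vector field `a`. -/
def Mgroup {n : ℕ} (a : Eucl n) : Set ℝ :=
  {α | α ≠ 0 ∧ ∃ R : Torus n → Torus n, IsGenSym a α R}

/-- The flow generated by the constant vector field `a` is smoothly semiconjugate to the flow
generated by the constant vector field `b` by the surjective map `V : T^n → T^n`: `V` admits a
`C^∞` lift `W` with `(DW(x))a = b` for all `x`. -/
def SmoothSemiconj {n : ℕ} (a b : Eucl n) (V : Torus n → Torus n) : Prop :=
  Function.Surjective V ∧ ∃ W : Eucl n → Eucl n, IsLift V W ∧ ContDiff ℝ (⊤ : ℕ∞) W ∧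
    ∀ x, fderiv ℝ W x a = b

/-- The numbers `ϑ * a 1, …, ϑ * a n` all lie in the subfield `F` of `ℝ` and form a basis of `F`
as a vector space over `ℚ`. -/
def IsAlgebraicFreq {n : ℕ} (a : Eucl n) (ϑ : ℝ) (F : Subfield ℝ) : Prop :=
  (∀ i, ϑ * a i ∈ F) ∧ LinearIndependent ℚ (fun i => ϑ * a i) ∧
    ∀ y ∈ F, ∃ q : Fin n → ℚ, y = ∑ i, (q i : ℝ) * (ϑ * a i)

section Fourier

open MeasureTheory UnitAddTorus

local instance : MeasureSpace UnitAddCircle := ⟨AddCircle.haarAddCircle⟩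

local instance : Measure.IsAddHaarMeasure (volume : Measure UnitAddCircle) :=
  inferInstanceAs (Measure.IsAddHaarMeasure AddCircle.haarAddCircle)

local instance : IsProbabilityMeasure (volume : Measure UnitAddCircle) :=
  inferInstanceAs (IsProbabilityMeasure AddCircle.haarAddCircle)

theorem QIndep.eq_zero_of_sum_int_mul_eq_zero {n : ℕ} {a : Eucl n} (ha : QIndep a)
    {m : Fin n → ℤ} (h : ∑ i, (m i : ℝ) * a i = 0) : m = 0 := by
  have h' : ∑ i, (m i : ℚ) • a i = 0 := by
    rw [← h]
    exact Finset.sum_congr rfl fun i _ => by rw [Rat.smul_def]; simp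
  funext i
  have := Fintype.linearIndependent_iff.1 ha (fun i => (m i : ℚ)) h' i
  simpa using this

theorem mFourier_add_point {d : Type*} [Fintype d] (m : d → ℤ) (x y : UnitAddTorus d) :
    mFourier m (x + y) = mFourier m x * mFourier m y := by
  simp [mFourier, fourier_apply, smul_add, AddCircle.toCircle_add, Finset.prod_mul_distrib]

theorem mFourier_coe {d : Type*} [Fintype d] (m : d → ℤ) (x : d → ℝ) :
    mFourier m (fun i => (x i : UnitAddCircle)) =
      Complex.exp (2 * Real.pi * Complex.I * ∑ i, (m i : ℝ) * x i) := by
  simp only [mFourier, ContinuousMap.coe_mk, fourier_coe_apply, ← Complex.exp_sum]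
  congr 1
  rw [Complex.ofReal_sum, Finset.mul_sum]
  exact Finset.sum_congr rfl fun i _ => by push_cast; ring

theorem mFourierCoeff_of_translate {d : Type*} [Fintype d] {F : UnitAddTorus d → ℂ}
    {y : UnitAddTorus d} (hF : ∀ x, F (x + y) = F x) (m : d → ℤ) :
    mFourierCoeff F m = mFourier (-m) y * mFourierCoeff F m := by
  unfold mFourierCoeff
  conv_lhs => rw [← integral_add_right_eq_self _ y]
  rw [← integral_const_mul]
  refine integral_congr_ae (.of_forall fun x => ?_)
  simp only [hF, mFourier_add_point, smul_eq_mul]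
  ring

/-- A continuous function on the torus which is invariant under a flow of `ℚ`-independent
frequency is constant. -/
theorem QIndep.eq_of_flow_invariant {n : ℕ} {a : Eucl n} (ha : QIndep a)
    (F : C(UnitAddTorus (Fin n), ℂ))
    (hF : ∀ (t : ℝ) (x : UnitAddTorus (Fin n)),
      F (x + fun i => ((t * a i : ℝ) : UnitAddCircle)) = F x) (x y : UnitAddTorus (Fin n)) :
    F x = F y := by
  have hcoeff : ∀ m : Fin n → ℤ, m ≠ 0 → mFourierCoeff F m = 0 := by
    intro m hm
    set s : ℝ := ∑ i, ((-m) i : ℝ) * a i with hs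
    have hs0 : s ≠ 0 := fun h => by
      have h' : -m = 0 := ha.eq_zero_of_sum_int_mul_eq_zero (by simpa [hs] using h)
      exact hm (neg_eq_zero.1 h')
    have key := mFourierCoeff_of_translate (hF (1 / (2 * s))) m
    rw [mFourier_coe] at key
    have hsum : ∑ i, ((-m) i : ℝ) * (1 / (2 * s) * a i) = 1 / 2 := by
      have : ∑ i, ((-m) i : ℝ) * (1 / (2 * s) * a i) = 1 / (2 * s) * s := by
        conv_rhs => rw [hs, Finset.mul_sum]
        exact Finset.sum_congr rfl fun i _ => by ring
      rw [this]
      field_simp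
    have hexp : Complex.exp (2 * Real.pi * Complex.I *
        ((∑ i, (((-m) i : ℤ) : ℝ) * (1 / (2 * s) * a i) : ℝ) : ℂ)) = -1 := by
      have : ∑ i, (((-m) i : ℤ) : ℝ) * (1 / (2 * s) * a i) = 1 / 2 := by
        simpa using hsum
      rw [this, ← Complex.exp_pi_mul_I]
      congr 1
      push_cast
      ring
    rw [hexp] at key
    linear_combination key / 2
  have hsummable : Summable (mFourierCoeff F) :=
    summable_of_ne_finset_zero (s := {0}) fun m hm => hcoeff m (by simpa using hm)
  have hconst : ∀ z, F z = mFourierCoeff F 0 := by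
    intro z
    have h1 := hasSum_mFourier_series_apply_of_summable hsummable z
    have h2 := hasSum_single (f := fun m => mFourierCoeff F m • mFourier m z) 0
      fun m hm => by simp [hcoeff m hm]
    simpa [mFourier_zero] using h1.unique h2
  rw [hconst x, hconst y]

end Fourier

/-- The covering of the torus, viewed as a product of circles, by Euclidean space. -/
def circleProj (n : ℕ) : C(Eucl n, UnitAddTorus (Fin n)) where
  toFun x i := (x i : UnitAddCircle)
  continuous_toFun := continuous_pi fun i =>
    (AddCircle.continuous_mk' 1).comp (continuous_apply i)

theorem isOpenQuotientMap_circleProj (n : ℕ) : IsOpenQuotientMap (circleProj n) :=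
  IsOpenQuotientMap.piMap fun _ => QuotientAddGroup.isOpenQuotientMap_mk

theorem circleProj_eq_iff {n : ℕ} {x y : Eucl n} :
    circleProj n x = circleProj n y ↔ ∃ m : Fin n → ℤ, y = x + intVec m := by
  constructor
  · intro h
    have : ∀ i, ∃ k : ℤ, y i = x i + k := by
      intro i
      have hi : ((x i : ℝ) : UnitAddCircle) = ((y i : ℝ) : UnitAddCircle) := congrFun h i
      have h0 : ((y i - x i : ℝ) : UnitAddCircle) = 0 := by
        rw [AddCircle.coe_sub, hi, sub_self]
      obtain ⟨k, hk⟩ := (AddCircle.coe_eq_zero_iff 1).1 h0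
      refine ⟨k, ?_⟩
      rw [zsmul_one] at hk
      linarith
    choose m hm using this
    exact ⟨m, funext hm⟩
  · rintro ⟨m, rfl⟩
    funext i
    change ((x i : ℝ) : UnitAddCircle) = ((x i + m i : ℝ) : UnitAddCircle)
    simp

/-- A continuous `ℤ^n`-periodic function that grows linearly along a flow of `ℚ`-independent
frequency is constant. -/
theorem QIndep.eq_of_periodic {n : ℕ} {a : Eucl n} (ha : QIndep a) {f : Eucl n → ℝ}
    (hf : Continuous f) (hper : ∀ x (m : Fin n → ℤ), f (x + intVec m) = f x) {s : ℝ}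
    (hs : ∀ x (t : ℝ), f (x + t • a) = f x + t * s) (x y : Eucl n) : f x = f y := by
  have hfact : Function.FactorsThrough (⟨f, hf⟩ : C(Eucl n, ℝ)) (circleProj n) := fun x y h => by
    obtain ⟨m, rfl⟩ := circleProj_eq_iff.1 h
    exact (hper x m).symm
  let F := (isOpenQuotientMap_circleProj n).isQuotientMap.lift ⟨f, hf⟩ hfact
  have hF : ∀ x, F (circleProj n x) = f x := DFunLike.congr_fun
    ((isOpenQuotientMap_circleProj n).isQuotientMap.lift_comp ⟨f, hf⟩ hfact)
  have hbound : ∀ x, |f x| ≤ ‖F‖ := fun x => by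
    rw [← hF]
    exact F.norm_coe_le_norm _
  have hs0 : s = 0 := by
    by_contra h
    have h1 := hs 0 ((2 * ‖F‖ + 1) / s)
    rw [div_mul_cancel₀ _ h] at h1
    have h2 := abs_le.1 (hbound 0)
    have h3 := abs_le.1 (hbound (0 + ((2 * ‖F‖ + 1) / s) • a))
    linarith [h2.1, h3.2]
  have := ha.eq_of_flow_invariant ((⟨Complex.ofReal, Complex.continuous_ofReal⟩ : C(ℝ, ℂ)).comp F)
    (fun t z => by
      obtain ⟨z, rfl⟩ := (isOpenQuotientMap_circleProj n).surjective z
      have hz : (circleProj n z + fun i => ((t * a i : ℝ) : UnitAddCircle)) =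
          circleProj n (z + t • a) := by
        funext i
        simp [circleProj]
      rw [hz]
      simp [hF, hs, hs0]) (circleProj n x) (circleProj n y)
  simpa [hF] using this

open Matrix

theorem continuous_intVec_iff {n : ℕ} {X : Type*} [TopologicalSpace X] {k : X → Fin n → ℤ} :
    Continuous k ↔ Continuous fun x => intVec (k x) := by
  simp only [continuous_pi_iff]
  exact forall_congr' fun i => Int.isClosedEmbedding_coe_real.isInducing.continuous_iff

theorem intVec_add {n : ℕ} (m k : Fin n → ℤ) : intVec (m + k) = intVec m + intVec k := by
  funext i
  simp [intVec]

theorem intVec_injective {n : ℕ} : Function.Injective (intVec (n := n)) := fun m k h =>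
  funext fun i => by simpa [intVec] using congrFun h i

theorem matR_mulVec_intVec {n : ℕ} (B : Matrix (Fin n) (Fin n) ℤ) (m : Fin n → ℤ) :
    matR B *ᵥ intVec m = intVec (B *ᵥ m) :=
  funext fun i => (RingHom.map_mulVec (Int.castRingHom ℝ) B m i).symm

theorem matR_mul {n : ℕ} (B C : Matrix (Fin n) (Fin n) ℤ) : matR (B * C) = matR B * matR C :=
  Matrix.map_mul (f := Int.castRingHom ℝ)

theorem matR_one {n : ℕ} : matR (1 : Matrix (Fin n) (Fin n) ℤ) = 1 :=
  Matrix.map_one _ Int.cast_zero Int.cast_one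

theorem torusPi_surjective (n : ℕ) : Function.Surjective (torusPi n) :=
  QuotientAddGroup.mk_surjective

theorem torusPi_eq_iff {n : ℕ} {x y : Eucl n} :
    torusPi n x = torusPi n y ↔ ∃ m : Fin n → ℤ, y = x + intVec m := by
  refine QuotientAddGroup.eq.trans ⟨?_, ?_⟩
  · rintro ⟨m, hm⟩
    exact ⟨m, by rw [hm]; abel⟩
  · rintro ⟨m, rfl⟩
    exact ⟨m, by abel⟩

theorem IsLift.iterate {n : ℕ} {V : Torus n → Torus n} {W : Eucl n → Eucl n} (h : IsLift V W)
    (k : ℕ) : IsLift V^[k] W^[k] := fun x =>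
  (Function.Semiconj.iterate_right (f := torusPi n) (fun x => (h x).symm) k x).symm

theorem IsLift.exists_translation {n : ℕ} {V : Torus n → Torus n} {W : Eucl n → Eucl n}
    (h : IsLift V W) (hW : Continuous W) (m : Fin n → ℤ) :
    ∃ k : Fin n → ℤ, ∀ x, W (x + intVec m) = W x + intVec k := by
  have hex : ∀ x, ∃ k : Fin n → ℤ, W (x + intVec m) = W x + intVec k := fun x => by
    rw [← torusPi_eq_iff, ← h, ← h, torusPi_eq_iff.2 ⟨m, rfl⟩]
  choose k hk using hex
  have hcont : Continuous k := by
    rw [continuous_intVec_iff]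
    have : (fun x => intVec (k x)) = fun x => W (x + intVec m) - W x := by
      funext x
      rw [hk]
      abel
    rw [this]
    fun_prop
  refine ⟨k 0, fun x => ?_⟩
  rw [hk, PreconnectedSpace.constant inferInstance hcont (x := x) (y := 0)]

/-- The action on the fundamental group of a continuous torus map, as an integer matrix. -/
theorem IsLift.exists_matrix {n : ℕ} {V : Torus n → Torus n} {W : Eucl n → Eucl n}
    (h : IsLift V W) (hW : Continuous W) :
    ∃ B : Matrix (Fin n) (Fin n) ℤ,
      ∀ x m, W (x + intVec m) = W x + matR B *ᵥ intVec m := by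
  choose k hk using h.exists_translation hW
  have hadd : ∀ m m', k (m + m') = k m + k m' := fun m m' => intVec_injective <| by
    have h1 := hk (m + m') 0
    rw [intVec_add, ← add_assoc, hk, hk, add_assoc] at h1
    rw [intVec_add]
    exact (add_left_cancel h1).symm
  let K : (Fin n → ℤ) →+ (Fin n → ℤ) := AddMonoidHom.mk' k hadd
  refine ⟨LinearMap.toMatrix' K.toIntLinearMap, fun x m => ?_⟩
  rw [matR_mulVec_intVec, LinearMap.toMatrix'_mulVec]
  exact hk m x

theorem apply_add_smul_of_fderiv_eq {E F : Type*} [NormedAddCommGroup E] [NormedSpace ℝ E]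
    [NormedAddCommGroup F] [NormedSpace ℝ F] {W : E → F} (hW : Differentiable ℝ W) {a : E} {c : F}
    (hD : ∀ x, fderiv ℝ W x a = c) (x : E) (t : ℝ) : W (x + t • a) = W x + t • c := by
  have hderiv : ∀ s : ℝ, HasDerivAt (fun s : ℝ => W (x + s • a) - s • c) 0 s := fun s => by
    have h1 : HasDerivAt (fun s : ℝ => x + s • a) a s := by
      simpa using ((hasDerivAt_id s).smul_const a).const_add x
    have h2 := (hW (x + s • a)).hasFDerivAt.comp_hasDerivAt s h1
    rw [hD] at h2
    simpa using! h2.sub ((hasDerivAt_id s).smul_const c)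
  have := is_const_of_deriv_eq_zero (fun s => (hderiv s).differentiableAt)
    (fun s => (hderiv s).deriv) t 0
  simp only [zero_smul, add_zero, sub_zero] at this
  rw [← this]
  abel

/-- A smooth torus map sending the constant vector field of `ℚ`-independent frequency `a` to a
constant vector field is affine. -/
theorem IsLift.exists_affine {n : ℕ} {V : Torus n → Torus n} {W : Eucl n → Eucl n}
    (h : IsLift V W) (hW : Differentiable ℝ W) {a c : Eucl n} (ha : QIndep a)
    (hD : ∀ x, fderiv ℝ W x a = c) :
    ∃ (B : Matrix (Fin n) (Fin n) ℤ) (d : Eucl n),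
      W = (fun x => matR B *ᵥ x + d) ∧ matR B *ᵥ a = c := by
  obtain ⟨B, hB⟩ := h.exists_matrix hW.continuous
  have hflow := apply_add_smul_of_fderiv_eq hW hD
  have hconst : ∀ x, W x - matR B *ᵥ x = W 0 := fun x => funext fun i => by
    have := ha.eq_of_periodic (f := fun x => W x i - (matR B *ᵥ x) i)
      (s := c i - (matR B *ᵥ a) i)
      (((continuous_apply i).comp hW.continuous).sub
        ((continuous_apply i).comp (Continuous.matrix_mulVec continuous_const continuous_id)))
      (fun x m => by simp [hB, mulVec_add])
      (fun x t => by
        simp only [hflow, mulVec_add, mulVec_smul, Pi.add_apply, Pi.smul_apply, smul_eq_mul]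
        ring) x 0
    simpa using this
  have hWx : W = fun x => matR B *ᵥ x + W 0 := funext fun x => by
    rw [← hconst x]
    abel
  refine ⟨B, W 0, hWx, ?_⟩
  have h1 := hflow 0 1
  rw [hWx] at h1
  simpa [add_comm] using h1

theorem exists_isLift_affine {n : ℕ} (D : Matrix (Fin n) (Fin n) ℤ) (e : Eucl n) :
    ∃ Q : Torus n → Torus n, IsLift Q fun x => matR D *ᵥ x + e := by
  refine ⟨fun y => torusPi n (matR D *ᵥ Function.surjInv (torusPi_surjective n) y + e),
    fun x => torusPi_eq_iff.2 ?_⟩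
  obtain ⟨m, hm⟩ := torusPi_eq_iff.1
    (Function.surjInv_eq (torusPi_surjective n) (torusPi n x))
  refine ⟨D *ᵥ m, ?_⟩
  conv_lhs => rw [hm]
  beta_reduce
  rw [mulVec_add, matR_mulVec_intVec]
  abel

theorem IsLift.leftInverse {n : ℕ} {V V' : Torus n → Torus n} {W W' : Eucl n → Eucl n}
    (h : IsLift V W) (h' : IsLift V' W') (hW : Function.LeftInverse W' W) :
    Function.LeftInverse V' V := fun y => by
  obtain ⟨x, rfl⟩ := torusPi_surjective n y
  rw [h, h', hW]

theorem leftInverse_affine {n : ℕ} {C D : Matrix (Fin n) (Fin n) ℤ} (h : C * D = 1) (e : Eucl n) :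
    Function.LeftInverse (fun x => matR C *ᵥ x + -(matR C *ᵥ e)) fun x => matR D *ᵥ x + e :=
  fun x => by simp [mulVec_add, mulVec_mulVec, ← matR_mul, h, matR_one]

theorem rightInverse_affine {n : ℕ} {C D : Matrix (Fin n) (Fin n) ℤ} (h : D * C = 1) (e : Eucl n) :
    Function.RightInverse (fun x => matR C *ᵥ x + -(matR C *ᵥ e)) fun x => matR D *ᵥ x + e :=
  fun x => by simp [mulVec_add, mulVec_neg, mulVec_mulVec, ← matR_mul, h, matR_one]

theorem hasFDerivAt_affine {n : ℕ} (D : Matrix (Fin n) (Fin n) ℤ) (e x : Eucl n) :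
    HasFDerivAt (fun x => matR D *ᵥ x + e) (matR D).mulVecLin.toContinuousLinearMap x :=
  (matR D).mulVecLin.toContinuousLinearMap.hasFDerivAt.add_const e

theorem contDiff_affine {n : ℕ} (D : Matrix (Fin n) (Fin n) ℤ) (e : Eucl n) :
    ContDiff ℝ (⊤ : ℕ∞) fun x => matR D *ᵥ x + e :=
  (matR D).mulVecLin.toContinuousLinearMap.contDiff.add contDiff_const

theorem IsLift.isGenSym_affine {n : ℕ} {D : Matrix (Fin n) (Fin n) ℤ} (hD : IsUnit D) {e : Eucl n}
    {b : Eucl n} {β : ℝ} (hb : matR D *ᵥ b = β • b) {Q : Torus n → Torus n}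
    (hQ : IsLift Q fun x => matR D *ᵥ x + e) : IsGenSym b β Q := by
  obtain ⟨C, hDC, hCD⟩ := isUnit_iff_exists.1 hD
  obtain ⟨Q', hQ'⟩ := exists_isLift_affine C (-(matR C *ᵥ e))
  have hl := leftInverse_affine hCD e
  have hr := rightInverse_affine hDC e
  refine ⟨⟨(hQ.leftInverse hQ' hl).injective, (hQ'.leftInverse hQ hr).surjective⟩, _, hQ,
    ⟨contDiff_affine D e, _, contDiff_affine C _, hl, hr⟩, fun x => ?_⟩
  rw [(hasFDerivAt_affine D e x).fderiv]
  exact hb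

theorem IsLift.isUnit_of_surjective {n : ℕ} {C : Matrix (Fin n) (Fin n) ℤ} {d : Eucl n}
    {R : Torus n → Torus n} (h : IsLift R fun x => matR C *ᵥ x + d) (hR : Function.Injective R)
    (hsurj : Function.Surjective fun x => matR C *ᵥ x + d) : IsUnit C := by
  refine mulVec_surjective_iff_isUnit.1 fun m => ?_
  obtain ⟨x, hx⟩ := hsurj (intVec m + d)
  have hx' : matR C *ᵥ x = intVec m := add_right_cancel hx
  have h0 : torusPi n 0 = torusPi n x := hR <| by
    rw [h, h, torusPi_eq_iff]
    exact ⟨m, by simp [hx', add_comm]⟩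
  obtain ⟨k, rfl⟩ := torusPi_eq_iff.1 h0
  rw [zero_add, matR_mulVec_intVec] at hx'
  exact ⟨k, intVec_injective hx'⟩

theorem IsLift.det_ne_zero {n : ℕ} {B : Matrix (Fin n) (Fin n) ℤ} {d : Eucl n}
    {V : Torus n → Torus n} (h : IsLift V fun x => matR B *ᵥ x + d) (hV : Function.Surjective V) :
    B.det ≠ 0 := fun hdet => by
  obtain ⟨v, hv, hvB⟩ := exists_vecMul_eq_zero_iff.2 hdet
  have hvB' : intVec v ᵥ* matR B = 0 := funext fun i => by
    have := RingHom.map_vecMul (Int.castRingHom ℝ) B v i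
    rw [hvB, Pi.zero_apply, map_zero] at this
    exact this.symm
  have hS : intVec v ⬝ᵥ intVec v ≠ 0 := fun h0 =>
    hv <| intVec_injective <| (dotProduct_self_eq_zero.1 h0).trans <| by
      funext i
      simp [intVec]
  set S := intVec v ⬝ᵥ intVec v
  obtain ⟨y, hy⟩ := hV (torusPi n ((1 / (2 * S)) • intVec v + d))
  obtain ⟨x, rfl⟩ := torusPi_surjective n y
  rw [h] at hy
  obtain ⟨m, hm⟩ := torusPi_eq_iff.1 hy
  have hm' : (1 / (2 * S)) • intVec v = matR B *ᵥ x + intVec m :=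
    add_right_cancel (hm.trans (add_right_comm _ _ _))
  have hdot := congrArg (intVec v ⬝ᵥ ·) hm'
  simp only [dotProduct_smul, dotProduct_add, dotProduct_mulVec, hvB', zero_dotProduct, zero_add,
    smul_eq_mul] at hdot
  have hint : intVec v ⬝ᵥ intVec m = ((v ⬝ᵥ m : ℤ) : ℝ) :=
    (RingHom.map_dotProduct (Int.castRingHom ℝ) v m).symm
  have hhalf : 1 / (2 * S) * S = 1 / 2 := by field_simp
  change 1 / (2 * S) * S = _ at hdot
  rw [hint, hhalf] at hdot
  have : (1 : ℤ) = 2 * (v ⬝ᵥ m) := by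
    have : (1 : ℝ) = 2 * ((v ⬝ᵥ m : ℤ) : ℝ) := by linarith
    exact_mod_cast this
  omega

theorem exists_pow_eq_one_add_smul {n : ℕ} {C : Matrix (Fin n) (Fin n) ℤ} (hC : IsUnit C) {N : ℤ}
    (hN : N ≠ 0) : ∃ k : ℕ, 0 < k ∧ ∃ M : Matrix (Fin n) (Fin n) ℤ, C ^ k = 1 + N • M := by
  have : NeZero N.natAbs := ⟨Int.natAbs_ne_zero.2 hN⟩
  let φ := (Int.castRingHom (ZMod N.natAbs)).mapMatrix (m := Fin n)
  obtain ⟨u, hu⟩ := hC.map φ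
  obtain ⟨k, hk, huk⟩ := (isOfFinOrder_of_finite u).exists_pow_eq_one
  have hφ : φ (C ^ k) = φ 1 := by
    rw [map_pow, map_one, ← hu, ← Units.val_pow_eq_pow_val, huk, Units.val_one]
  have hdvd : ∀ i j, N ∣ (C ^ k - 1) i j := fun i j => by
    rw [← Int.natAbs_dvd, ← ZMod.intCast_zmod_eq_zero_iff_dvd, Matrix.sub_apply, Int.cast_sub, sub_eq_zero]
    exact congrFun (congrFun hφ i) j
  choose M hM using hdvd
  refine ⟨k, hk, of M, ?_⟩
  rw [← sub_eq_iff_eq_add']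
  ext i j
  simpa using hM i j

/-- Some power of an invertible integer matrix is conjugated by a nonsingular integer matrix to an
invertible integer matrix. -/
theorem exists_pow_conj_isUnit {n : ℕ} {B C : Matrix (Fin n) (Fin n) ℤ} (hB : B.det ≠ 0)
    (hC : IsUnit C) :
    ∃ k : ℕ, 0 < k ∧ ∃ D : Matrix (Fin n) (Fin n) ℤ, IsUnit D ∧ D * B = B * C ^ k := by
  obtain ⟨k, hk, M, hM⟩ := exists_pow_eq_one_add_smul hC hB
  have hDB : (1 + B * M * B.adjugate) * B = B * C ^ k := by
    rw [hM, add_mul, mul_assoc, adjugate_mul, mul_add, Matrix.mul_smul,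
      Matrix.mul_smul, mul_one, mul_one, one_mul]
  refine ⟨k, hk, _, ?_, hDB⟩
  have hdet := congrArg det hDB
  rw [det_mul, det_mul, mul_comm] at hdet
  rw [isUnit_iff_isUnit_det, mul_left_cancel₀ hB hdet, ← isUnit_iff_isUnit_det]
  exact hC.pow k

theorem exists_iterate_affine {n : ℕ} (C : Matrix (Fin n) (Fin n) ℤ) (d : Eucl n) (k : ℕ) :
    ∃ e : Eucl n, (fun x => matR C *ᵥ x + d)^[k] = fun x => matR (C ^ k) *ᵥ x + e := by
  induction k with
  | zero => exact ⟨0, funext fun x => by simp [matR_one]⟩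
  | succ k ih =>
    obtain ⟨e, he⟩ := ih
    refine ⟨matR C *ᵥ e + d, funext fun x => ?_⟩
    rw [Function.iterate_succ_apply', he, pow_succ', matR_mul]
    simp [mulVec_add, mulVec_mulVec, add_assoc]

theorem matR_pow_mulVec {n : ℕ} {C : Matrix (Fin n) (Fin n) ℤ} {a : Eucl n} {α : ℝ}
    (h : matR C *ᵥ a = α • a) (k : ℕ) : matR (C ^ k) *ᵥ a = α ^ k • a := by
  induction k with
  | zero => simp [matR_one]
  | succ k ih =>
    rw [pow_succ, matR_mul, ← mulVec_mulVec, h, mulVec_smul, ih, smul_smul, pow_succ']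

/-- for each generalized symmetry `R` of the source flow with multiplier `α`, some
positive power `R^k` pushes forward to a generalized symmetry `Q` of the target flow with
multiplier `α^k`, with `Q ∘ V = V ∘ R^[k]`. -/
theorem stmt_12 (n : ℕ) (hn : 1 ≤ n) (a b : Eucl n) (ha : QIndep a)
    (V : Torus n → Torus n) (hsc : SmoothSemiconj a b V)
    (α : ℝ) (hα : α ≠ 0) (R : Torus n → Torus n) (hR : IsGenSym a α R) :
    ∃ k : ℕ, 0 < k ∧ ∃ Q : Torus n → Torus n,
      IsGenSym b (α ^ k) Q ∧ Q ∘ V = V ∘ R^[k] := by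
  obtain ⟨hV, W, hVW, hW, hWD⟩ := hsc
  obtain ⟨hRbij, Rh, hRRh, ⟨hRh, Rh', -, -, hright⟩, hRD⟩ := hR
  obtain ⟨B, c, rfl, hBa⟩ := hVW.exists_affine (hW.differentiable (by simp)) ha hWD
  obtain ⟨C, d, rfl, hCa⟩ := hRRh.exists_affine (hRh.differentiable (by simp)) ha hRD
  have hC : IsUnit C :=
    hRRh.isUnit_of_surjective hRbij.injective hright.surjective
  obtain ⟨k, hk, D, hD, hDB⟩ := exists_pow_conj_isUnit (hVW.det_ne_zero hV) hC
  obtain ⟨e, he⟩ := exists_iterate_affine C d k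
  have hRk := hRRh.iterate k
  rw [he] at hRk
  obtain ⟨Q, hQ⟩ := exists_isLift_affine D (matR B *ᵥ e + c - matR D *ᵥ c)
  have hDb : matR D *ᵥ b = α ^ k • b := by
    rw [← hBa, mulVec_mulVec, ← matR_mul, hDB, matR_mul, ← mulVec_mulVec, matR_pow_mulVec hCa,
      mulVec_smul]
  refine ⟨k, hk, Q, hQ.isGenSym_affine hD hDb, funext fun y => ?_⟩
  obtain ⟨x, rfl⟩ := torusPi_surjective n y
  simp only [Function.comp_apply, hVW x, hQ _, hRk x, hVW _]
  congr 1
  simp only [mulVec_add, mulVec_mulVec, ← matR_mul, hDB]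
  abel
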